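/- With p̃_N(z) = ∏_{j=1}^N (z + w_j), w_j ∈ 𝕋, and c(p̃_N) the closed span of {p̃_Nφ^λ : 0 ≤ λ ≤ δ} in H^2(𝔻), one has the orthogonal-complement identity (c(p̃_N) + φ^δK_{z^N})^⊥ = z^{N+1}φ^δH^2(𝔻), and consequently the closure of c(p̃_N) + K_{z^Nφ^δ} equals K_{z^{N+1}φ^δ}. -/

import Mathlib

open Complex MeasureTheory Metric Set

/-- Taylor coefficient at 0. -/
noncomputable def hcoeff (f : ℂ → ℂ) (n : ℕ) : ℂ := iteratedDeriv n f 0 / n.factorial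

/-- H² inner product via Taylor coefficients (conjugate-linear in first slot). -/
noncomputable def hinner (f g : ℂ → ℂ) : ℂ :=
  ∑' n : ℕ, (starRingEnd ℂ) (hcoeff f n) * hcoeff g n

/-- H² squared norm via Taylor coefficients. -/
noncomputable def hnormSq (f : ℂ → ℂ) : ℝ := ∑' n : ℕ, ‖hcoeff f n‖ ^ 2

/-- Membership in the Hardy space H²(𝔻). -/
def MemH2 (f : ℂ → ℂ) : Prop :=
  DifferentiableOn ℂ f (ball 0 1) ∧ Summable fun n : ℕ => ‖hcoeff f n‖ ^ 2

/-- Inner function on the unit disc. -/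
def IsInner (u : ℂ → ℂ) : Prop :=
  DifferentiableOn ℂ u (ball 0 1) ∧ (∀ z ∈ ball (0 : ℂ) 1, ‖u z‖ ≤ 1) ∧
    ∀ᵐ t : ℝ, Filter.Tendsto (fun r : ℝ => ‖u ((r : ℂ) * Complex.exp (Complex.I * t))‖)
      (nhdsWithin 1 (Set.Iio 1)) (nhds 1)

/-- Membership in the model space K_u = H² ⊖ uH². -/
def MemK (u f : ℂ → ℂ) : Prop :=
  MemH2 f ∧ ∀ g, MemH2 g → hinner (fun z => u z * g z) f = 0

/-- The powers of the atomic singular inner function. -/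
noncomputable def phi (lam : ℝ) (z : ℂ) : ℂ := Complex.exp (-(lam : ℂ) * (1 - z) / (1 + z))

/-- Membership in the closed linear span of a family {F λ : λ ∈ A} in H². -/
def InClosedSpan (F : ℝ → ℂ → ℂ) (A : Set ℝ) (f : ℂ → ℂ) : Prop :=
  MemH2 f ∧ ∀ ε > 0, ∃ (n : ℕ) (c : Fin n → ℂ) (lam : Fin n → ℝ),
    (∀ i, lam i ∈ A) ∧ hnormSq (fun z => f z - ∑ i, c i * F (lam i) z) < ε


namespace Hardy

open Filter Topology
open scoped ComplexConjugate

/-- Power series representation on the unit disc. -/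
def PS (f : ℂ → ℂ) (a : ℕ → ℂ) : Prop :=
  ∀ z ∈ ball (0 : ℂ) 1, HasSum (fun n => a n * z ^ n) (f z)

lemma PS.hasFPowerSeriesAt {f : ℂ → ℂ} {a : ℕ → ℂ} (h : PS f a) :
    HasFPowerSeriesAt f (FormalMultilinearSeries.ofScalars ℂ a) 0 := by
  rw [hasFPowerSeriesAt_iff]
  filter_upwards [ball_mem_nhds (0 : ℂ) one_pos] with z hz
  simpa [FormalMultilinearSeries.coeff_ofScalars, mul_comm] using h z hz

lemma PS.coeff_eq {f : ℂ → ℂ} {a : ℕ → ℂ} (h : PS f a) (n : ℕ) : hcoeff f n = a n := by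
  have h1 := h.hasFPowerSeriesAt
  have h2 := AnalyticAt.hasFPowerSeriesAt ⟨_, h1⟩
  have h3 := h2.eq_formalMultilinearSeries h1
  have := FormalMultilinearSeries.ofScalars_series_injective ℂ ℂ h3
  exact congrFun this n

lemma PS.differentiableOn {f : ℂ → ℂ} {a : ℕ → ℂ} (h : PS f a) :
    DifferentiableOn ℂ f (ball 0 1) := by
  have : HasFPowerSeriesOnBall f (FormalMultilinearSeries.ofScalars ℂ a) 0 1 := by
    refine ⟨?_, one_pos, ?_⟩
    · apply ENNReal.le_of_forall_nnreal_lt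
      intro r hr
      apply FormalMultilinearSeries.le_radius_of_tendsto (l := 0)
      have hr' : ((r : ℝ) : ℂ) ∈ ball (0 : ℂ) 1 := by
        have : (r : ℝ) < 1 := by exact_mod_cast hr
        simpa using this
      have := (h _ hr').summable.tendsto_atTop_zero.norm
      simpa [FormalMultilinearSeries.coeff_ofScalars] using this
    · intro y hy
      have hy' : y ∈ ball (0 : ℂ) 1 := by
        simpa [← ENNReal.ofReal_one, Metric.eball_ofReal] using hy
      simpa [FormalMultilinearSeries.coeff_ofScalars, mul_comm,
        FormalMultilinearSeries.apply_eq_pow_smul_coeff] using h y hy'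
  have := this.differentiableOn
  rwa [← ENNReal.ofReal_one, Metric.eball_ofReal] at this

lemma PS.of_differentiableOn {f : ℂ → ℂ} (h : DifferentiableOn ℂ f (ball 0 1)) :
    PS f (hcoeff f) := by
  intro z hz
  have := Complex.hasSum_taylorSeries_on_ball h hz
  refine this.congr_fun ?_
  intro n
  simp only [hcoeff, sub_zero, smul_eq_mul]
  ring

lemma PS.congr {f g : ℂ → ℂ} {a : ℕ → ℂ} (h : PS f a) (hfg : EqOn g f (ball 0 1)) : PS g a := by
  intro z hz
  rw [hfg hz]; exact h z hz

lemma PS.unique {f : ℂ → ℂ} {a b : ℕ → ℂ} (h : PS f a) (h' : PS f b) : a = b := by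
  ext n; rw [← h.coeff_eq, h'.coeff_eq]

lemma PS.parseval {f : ℂ → ℂ} {a : ℕ → ℂ} (h : PS f a) {r : ℝ} (hr0 : 0 ≤ r) (hr1 : r < 1) :
    HasSum (fun n => ‖a n‖ ^ 2 * r ^ (2 * n))
      (∫ t : UnitAddCircle, ‖f (r * AddCircle.toCircle t)‖ ^ 2 ∂AddCircle.haarAddCircle) := by
  have hmem : ∀ t : UnitAddCircle, (r : ℂ) * AddCircle.toCircle t ∈ ball (0 : ℂ) 1 := by
    intro t
    have : ‖(AddCircle.toCircle t : ℂ)‖ = 1 := Circle.norm_coe _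
    simpa [abs_of_nonneg hr0, this] using hr1
  have hcont : Continuous fun t : UnitAddCircle => f (r * AddCircle.toCircle t) := by
    apply h.differentiableOn.continuousOn.comp_continuous _ hmem
    have := (AddCircle.continuous_toCircle (T := 1))
    fun_prop
  let F : C(UnitAddCircle, ℂ) := ⟨_, hcont⟩
  have hsn : Summable fun n => ‖a n‖ * r ^ n := by
    have : (r : ℂ) ∈ ball (0 : ℂ) 1 := by simpa [abs_of_nonneg hr0] using hr1
    simpa [abs_of_nonneg hr0] using (h _ this).summable.norm
  have hF : HasSum (fun n : ℕ => (a n * r ^ n) • (fourier n : C(UnitAddCircle, ℂ))) F := by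
    have hs : Summable (fun n : ℕ => (a n * r ^ n) • (fourier n : C(UnitAddCircle, ℂ))) := by
      apply Summable.of_norm
      simpa [norm_smul, fourier_norm, abs_of_nonneg hr0] using hsn
    have h1 := hs.hasSum
    convert h1
    ext t
    have h2 := ContinuousMap.hasSum_apply h1 t
    have h3 := h _ (hmem t)
    refine h3.unique (h2.congr_fun ?_)
    intro n
    simp [fourier_apply, mul_pow, AddCircle.toCircle_nsmul, mul_assoc]
  have hF2 := hF.mapL (ContinuousMap.toLp 2 (AddCircle.haarAddCircle (T := 1)) ℂ (E := ℂ))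
  have hn : ‖ContinuousMap.toLp 2 (AddCircle.haarAddCircle (T := 1)) ℂ F‖ ^ 2 =
      ∫ t : UnitAddCircle, ‖f (r * AddCircle.toCircle t)‖ ^ 2 ∂AddCircle.haarAddCircle := by
    rw [← inner_self_eq_norm_sq (𝕜 := ℂ), ContinuousMap.inner_toLp]
    have : ∀ x : UnitAddCircle, F x * conj (F x) = ((‖F x‖ ^ 2 : ℝ) : ℂ) := by
      intro x
      rw [Complex.mul_conj, Complex.normSq_eq_norm_sq]
    simp_rw [this]
    rw [integral_complex_ofReal]
    simp [F]
  rw [← hn]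
  have h4 := (hF2.norm.pow 2)
  refine h4.congr ?_
  intro s
  have ho := (orthonormal_fourier (T := 1)).comp (fun n : ℕ => (n : ℤ)) Nat.cast_injective
  have h5 : ∀ n : ℕ, ContinuousMap.toLp 2 (AddCircle.haarAddCircle (T := 1)) ℂ
      ((a n * r ^ n) • (fourier n : C(UnitAddCircle, ℂ))) =
      (a n * r ^ n) • fourierLp (T := 1) 2 (n : ℤ) := fun n => map_smul _ _ _
  have h6 := ho.inner_sum (fun n => a n * r ^ n) (fun n => a n * r ^ n) s
  rw [← inner_self_eq_norm_sq (𝕜 := ℂ)]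
  simp_rw [h5]
  erw [h6]
  rw [map_sum]
  refine Finset.sum_congr rfl fun n _ => ?_
  rw [← Complex.normSq_eq_conj_mul_self, Complex.normSq_eq_norm_sq]
  rw [RCLike.re_to_complex, Complex.ofReal_re, norm_mul, norm_pow, Complex.norm_real,
    Real.norm_of_nonneg hr0]
  ring

end Hardy

namespace Hardy

open Filter Topology
open scoped ComplexConjugate

/-- The sequence model of the Hardy space. -/
noncomputable abbrev H := lp (fun _ : ℕ => ℂ) 2

/-- The analytic function attached to a sequence. -/
noncomputable def fn (a : H) (z : ℂ) : ℂ := ∑' n, a n * z ^ n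

lemma ps_fn (a : H) : PS (fn a) a := by
  intro z hz
  have hz' : ‖z‖ < 1 := by simpa using hz
  apply Summable.hasSum
  apply Summable.of_norm_bounded ((summable_geometric_of_lt_one (norm_nonneg z) hz').mul_left ‖a‖)
  intro n
  rw [norm_mul, norm_pow]
  gcongr
  exact lp.norm_apply_le_norm (by norm_num) a n

lemma hasSum_normSq (a : H) : HasSum (fun n => ‖a n‖ ^ 2) (‖a‖ ^ 2) := by
  have := lp.hasSum_norm (p := 2) (by norm_num) a
  simpa using this

/-- Bundle a square summable sequence. -/
noncomputable def mkH (a : ℕ → ℂ) (h : Summable fun n => ‖a n‖ ^ 2) : H :=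
  ⟨a, by
    apply memℓp_gen
    simpa using h⟩

lemma mkH_apply (a : ℕ → ℂ) (h : Summable fun n => ‖a n‖ ^ 2) (n : ℕ) : mkH a h n = a n := rfl

lemma mkH_coe (a : ℕ → ℂ) (h : Summable fun n => ‖a n‖ ^ 2) : (mkH a h : ℕ → ℂ) = a := rfl

lemma PS.eq_fn {f : ℂ → ℂ} {a : H} (h : PS f a) {z : ℂ} (hz : z ∈ ball (0 : ℂ) 1) :
    f z = fn a z := (h z hz).unique (ps_fn a z hz)

lemma ext_fn {a b : H} (h : EqOn (fn a) (fn b) (ball 0 1)) : a = b := by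
  apply lp.ext
  exact (ps_fn a).unique ((ps_fn b).congr h)

lemma fn_add (a b : H) {z : ℂ} (hz : z ∈ ball (0 : ℂ) 1) : fn (a + b) z = fn a z + fn b z := by
  refine ((ps_fn (a + b)) z hz).unique ?_
  refine ((ps_fn a z hz).add (ps_fn b z hz)).congr_fun ?_
  intro n
  simp [add_mul]

lemma fn_smul (c : ℂ) (a : H) {z : ℂ} (hz : z ∈ ball (0 : ℂ) 1) : fn (c • a) z = c * fn a z := by
  refine ((ps_fn (c • a)) z hz).unique ?_
  refine ((ps_fn a z hz).mul_left c).congr_fun ?_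
  intro n
  simp [mul_assoc]

lemma mult_bound {u : ℂ → ℂ} (hb : ∀ z ∈ ball (0 : ℂ) 1, ‖u z‖ ≤ 1) (a : H) {b : ℕ → ℂ}
    (h : PS (fun z => u z * fn a z) b) (s : Finset ℕ) : ∑ n ∈ s, ‖b n‖ ^ 2 ≤ ‖a‖ ^ 2 := by
  have key : ∀ r ∈ Ico (0 : ℝ) 1, ∑ n ∈ s, ‖b n‖ ^ 2 * r ^ (2 * n) ≤ ‖a‖ ^ 2 := by
    intro r ⟨hr0, hr1⟩
    have h1 := h.parseval hr0 hr1
    have h2 := (ps_fn a).parseval hr0 hr1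
    have hmem : ∀ t : UnitAddCircle, (r : ℂ) * AddCircle.toCircle t ∈ ball (0 : ℂ) 1 := by
      intro t
      have : ‖(AddCircle.toCircle t : ℂ)‖ = 1 := Circle.norm_coe _
      simpa [abs_of_nonneg hr0, this] using hr1
    have hcont : ∀ f : ℂ → ℂ, ContinuousOn f (ball 0 1) →
        Continuous fun t : UnitAddCircle => f (r * AddCircle.toCircle t) := by
      intro f hf
      apply hf.comp_continuous _ hmem
      have := (AddCircle.continuous_toCircle (T := 1))
      fun_prop
    have hInt : ∀ f : ℂ → ℂ, ContinuousOn f (ball 0 1) →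
        Integrable (fun t : UnitAddCircle => ‖f (r * AddCircle.toCircle t)‖ ^ 2)
          AddCircle.haarAddCircle := fun f hf =>
      ((hcont f hf).norm.pow 2).integrable_of_hasCompactSupport
        (HasCompactSupport.of_compactSpace _)
    calc ∑ n ∈ s, ‖b n‖ ^ 2 * r ^ (2 * n) ≤ _ := sum_le_hasSum s (fun n _ => by positivity) h1
      _ ≤ _ := by
        apply integral_mono (hInt _ h.differentiableOn.continuousOn)
          (hInt _ (ps_fn a).differentiableOn.continuousOn)
        intro t
        simp only [norm_mul]
        gcongr
        exact mul_le_of_le_one_left (norm_nonneg _) (hb _ (hmem t))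
      _ ≤ ‖a‖ ^ 2 := by
        refine hasSum_le (fun n => ?_) h2 (hasSum_normSq a)
        exact mul_le_of_le_one_right (by positivity) (pow_le_one₀ hr0 hr1.le)
  have hc : Continuous fun r : ℝ => ∑ n ∈ s, ‖b n‖ ^ 2 * r ^ (2 * n) := by fun_prop
  have h1 : Tendsto (fun r : ℝ => ∑ n ∈ s, ‖b n‖ ^ 2 * r ^ (2 * n)) (𝓝[<] 1)
      (𝓝 (∑ n ∈ s, ‖b n‖ ^ 2)) := by
    have := (hc.tendsto 1).mono_left (nhdsWithin_le_nhds (s := Iio 1))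
    simpa using this
  refine le_of_tendsto h1 ?_
  filter_upwards [Ico_mem_nhdsLT (zero_lt_one' ℝ)] with r hr using key r hr

lemma exists_mult {u : ℂ → ℂ} (hd : DifferentiableOn ℂ u (ball 0 1))
    (hb : ∀ z ∈ ball (0 : ℂ) 1, ‖u z‖ ≤ 1) :
    ∃ T : H →L[ℂ] H, (∀ a, ∀ z ∈ ball (0 : ℂ) 1, fn (T a) z = u z * fn a z) ∧
      ∀ a, ‖T a‖ ≤ ‖a‖ := by
  have hps : ∀ a : H, PS (fun z => u z * fn a z) (hcoeff (fun z => u z * fn a z)) := fun a =>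
    PS.of_differentiableOn (hd.mul (ps_fn a).differentiableOn)
  have hs : ∀ a : H, Summable fun n => ‖hcoeff (fun z => u z * fn a z) n‖ ^ 2 := fun a =>
    summable_of_sum_le (fun n => by positivity) (mult_bound hb a (hps a))
  let T₀ : H → H := fun a => mkH _ (hs a)
  have hT : ∀ a, ∀ z ∈ ball (0 : ℂ) 1, fn (T₀ a) z = u z * fn a z := fun a z hz =>
    (PS.eq_fn (a := T₀ a) (hps a) hz).symm
  have hn : ∀ a, ‖T₀ a‖ ≤ 1 * ‖a‖ := by
    intro a
    rw [one_mul]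
    apply le_of_sq_le_sq _ (norm_nonneg _)
    exact le_of_tendsto (hasSum_normSq (T₀ a)) (Eventually.of_forall (mult_bound hb a (hps a)))
  let T₁ : H →ₗ[ℂ] H :=
    { toFun := T₀
      map_add' := fun a b => ext_fn fun z hz => by
        rw [hT _ _ hz, fn_add _ _ hz, fn_add _ _ hz, hT _ _ hz, hT _ _ hz, mul_add]
      map_smul' := fun c a => ext_fn fun z hz => by
        rw [RingHom.id_apply, hT _ _ hz, fn_smul _ _ hz, fn_smul _ _ hz, hT _ _ hz]
        ring }
  refine ⟨T₁.mkContinuous 1 hn, fun a z hz => hT a z hz, fun a => (hn a).trans_eq (one_mul _)⟩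

end Hardy

namespace Hardy

open Filter Topology
open scoped ComplexConjugate

lemma exists_shift : ∃ T : H →L[ℂ] H, (∀ a, ∀ z ∈ ball (0 : ℂ) 1, fn (T a) z = z * fn a z) ∧
      ∀ a, ‖T a‖ ≤ ‖a‖ :=
  exists_mult (u := fun z => z) differentiableOn_id (fun z hz => by simpa using (mem_ball_zero_iff.1 hz).le)

/-- The shift operator. -/
noncomputable def S : H →L[ℂ] H := exists_shift.choose

lemma fn_S (a : H) {z : ℂ} (hz : z ∈ ball (0 : ℂ) 1) : fn (S a) z = z * fn a z :=
  exists_shift.choose_spec.1 a z hz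

lemma S_coe (a : H) : (S a : ℕ → ℂ) = fun n => Nat.casesOn n 0 (fun m => a m) := by
  have h : PS (fn (S a)) (fun n => Nat.casesOn n 0 (fun m => a m)) := by
    intro z hz
    rw [fn_S a hz, ← hasSum_nat_add_iff' 1]
    have h0 : z * fn a z - ∑ i ∈ Finset.range 1,
        (fun n => Nat.casesOn n 0 (fun m => a m) : ℕ → ℂ) i * z ^ i = z * fn a z := by simp
    rw [h0]
    refine ((ps_fn a z hz).mul_left z).congr_fun ?_
    intro n
    simp only
    ring
  exact (ps_fn (S a)).unique h

lemma S_zero (a : H) : S a 0 = 0 := by rw [S_coe]; rfl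

lemma S_succ (a : H) (n : ℕ) : S a (n + 1) = a n := by rw [S_coe]

lemma norm_S (a : H) : ‖S a‖ = ‖a‖ := by
  have h1 := hasSum_normSq (S a)
  rw [← hasSum_nat_add_iff' 1] at h1
  simp only [Finset.range_one, Finset.sum_singleton, S_zero, S_succ] at h1
  have := h1.unique (hasSum_normSq a)
  simp only [norm_zero, ne_eq, OfNat.ofNat_ne_zero, not_false_eq_true, zero_pow, sub_zero] at this
  exact (sq_eq_sq₀ (norm_nonneg _) (norm_nonneg _)).1 this

lemma inner_of_isometry {T : H →L[ℂ] H} (h : ∀ a, ‖T a‖ = ‖a‖) (a b : H) :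
    inner ℂ (T a) (T b) = inner ℂ a b :=
  LinearIsometry.inner_map_map (⟨T.toLinearMap, h⟩ : H →ₗᵢ[ℂ] H) a b

/-- Standard basis. -/
noncomputable def e (n : ℕ) : H := lp.single 2 n (1 : ℂ)

lemma inner_e (n : ℕ) (a : H) : inner ℂ (e n) a = a n := by
  rw [e, lp.inner_single_left]; simp

lemma norm_e (n : ℕ) : ‖e n‖ = 1 := by
  rw [e, lp.norm_single (by norm_num)]; simp

lemma e_apply (n m : ℕ) : e n m = if m = n then 1 else 0 := by
  rw [e, lp.single_apply, Pi.single_apply]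

lemma S_e (n : ℕ) : S (e n) = e (n + 1) := by
  apply lp.ext
  ext m
  cases m with
  | zero => rw [S_zero, e_apply]; simp
  | succ m => rw [S_succ, e_apply, e_apply]; simp

lemma S_pow_e (n : ℕ) : (S ^ n) (e 0) = e n := by
  induction n with
  | zero => simp
  | succ n ih => rw [pow_succ', mul_apply_eq_comp, ih, S_e]

lemma fn_e (z : ℂ) : fn (e 0) z = 1 := by
  rw [fn, tsum_eq_single 0]
  · simp [e_apply]
  · intro n hn; simp [e_apply, hn]

lemma ext_e {k : H} (h : ∀ n, inner ℂ (e n) k = 0) : k = 0 := by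
  apply lp.ext
  ext n
  rw [← inner_e, h]; rfl

lemma fn_S_pow (n : ℕ) (a : H) {z : ℂ} (hz : z ∈ ball (0 : ℂ) 1) :
    fn ((S ^ n) a) z = z ^ n * fn a z := by
  induction n with
  | zero => simp
  | succ n ih => rw [pow_succ', mul_apply_eq_comp, fn_S _ hz, ih]; ring

lemma norm_S_pow (n : ℕ) (a : H) : ‖(S ^ n) a‖ = ‖a‖ := by
  induction n with
  | zero => simp
  | succ n ih => rw [pow_succ', mul_apply_eq_comp, norm_S, ih]

lemma S_pow_apply_lt (M n : ℕ) (a : H) (h : n < M) : (S ^ M) a n = 0 := by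
  induction M generalizing n with
  | zero => omega
  | succ M ih =>
    rw [pow_succ', mul_apply_eq_comp]
    cases n with
    | zero => rw [S_zero]
    | succ n => rw [S_succ, ih n (by omega)]

lemma S_pow_apply_self (M : ℕ) (a : H) : (S ^ M) a M = a 0 := by
  induction M with
  | zero => simp
  | succ M ih => rw [pow_succ', mul_apply_eq_comp, S_succ, ih]

lemma eq_S_of_zero {h : H} (h0 : h 0 = 0) : ∃ h', h = S h' := by
  refine ⟨mkH (fun n => h (n + 1)) ?_, ?_⟩
  · exact (summable_nat_add_iff 1).2 (hasSum_normSq h).summable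
  · apply lp.ext
    ext n
    cases n with
    | zero => rw [S_zero, h0]
    | succ n => rw [S_succ, mkH_apply]

lemma re_cayley (z : ℂ) (hz : ‖z‖ ≤ 1) : 0 ≤ ((1 - z) / (1 + z)).re := by
  rw [Complex.div_re, ← add_div]
  apply div_nonneg _ (Complex.normSq_nonneg _)
  have : ‖z‖ ^ 2 ≤ 1 := pow_le_one₀ (norm_nonneg _) hz
  rw [← Complex.normSq_eq_norm_sq, Complex.normSq_apply] at this
  simp
  nlinarith

lemma re_cayley_circle (z : ℂ) (hz : ‖z‖ = 1) : ((1 - z) / (1 + z)).re = 0 := by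
  rw [Complex.div_re, ← add_div]
  have : ‖z‖ ^ 2 = 1 := by rw [hz]; norm_num
  rw [← Complex.normSq_eq_norm_sq, Complex.normSq_apply] at this
  apply div_eq_zero_iff.2; left
  simp
  nlinarith

lemma norm_phi (lam : ℝ) (z : ℂ) : ‖phi lam z‖ = Real.exp (-lam * ((1 - z) / (1 + z)).re) := by
  rw [phi, Complex.norm_exp, mul_div_assoc, ← Complex.ofReal_neg, Complex.re_ofReal_mul]

lemma one_add_ne {z : ℂ} (hz : z ∈ ball (0 : ℂ) 1) : 1 + z ≠ 0 := by
  intro h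
  have : z = -1 := by linear_combination h
  simp [this] at hz

lemma phi_diff (lam : ℝ) : DifferentiableOn ℂ (phi lam) (ball 0 1) := by
  intro z hz
  have := one_add_ne hz
  apply DifferentiableAt.differentiableWithinAt
  unfold phi
  fun_prop (disch := assumption)

lemma phi_bound {lam : ℝ} (h : 0 ≤ lam) (z : ℂ) (hz : z ∈ ball (0 : ℂ) 1) : ‖phi lam z‖ ≤ 1 := by
  rw [norm_phi, Real.exp_le_one_iff]
  have := re_cayley z (by simpa using (mem_ball_zero_iff.1 hz).le)
  nlinarith [mul_nonneg h this]

lemma phi_add (s t : ℝ) (z : ℂ) : phi (s + t) z = phi s z * phi t z := by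
  rw [phi, phi, phi, ← Complex.exp_add]
  congr 1
  push_cast
  ring

/-- Multiplication by `phi |lam|`. -/
noncomputable def T (lam : ℝ) : H →L[ℂ] H :=
  (exists_mult (phi_diff |lam|) (phi_bound (abs_nonneg lam))).choose

lemma fn_T_abs (lam : ℝ) (a : H) {z : ℂ} (hz : z ∈ ball (0 : ℂ) 1) :
    fn (T lam a) z = phi |lam| z * fn a z :=
  (exists_mult (phi_diff |lam|) (phi_bound (abs_nonneg lam))).choose_spec.1 a z hz

lemma fn_T {lam : ℝ} (h : 0 ≤ lam) (a : H) {z : ℂ} (hz : z ∈ ball (0 : ℂ) 1) :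
    fn (T lam a) z = phi lam z * fn a z := by
  rw [fn_T_abs _ _ hz, abs_of_nonneg h]

lemma T_abs (lam : ℝ) (a : H) : T |lam| a = T lam a :=
  ext_fn fun z hz => by rw [fn_T_abs _ _ hz, fn_T_abs _ _ hz, abs_abs]

lemma norm_T_le (lam : ℝ) (a : H) : ‖T lam a‖ ≤ ‖a‖ :=
  (exists_mult (phi_diff |lam|) (phi_bound (abs_nonneg lam))).choose_spec.2 a

lemma T_add {s t : ℝ} (hs : 0 ≤ s) (ht : 0 ≤ t) (a : H) : T (s + t) a = T s (T t a) :=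
  ext_fn fun z hz => by
    rw [fn_T (add_nonneg hs ht) _ hz, fn_T hs _ hz, fn_T ht _ hz, phi_add, mul_assoc]

lemma T_S_pow (lam : ℝ) (n : ℕ) (a : H) : T lam ((S ^ n) a) = (S ^ n) (T lam a) :=
  ext_fn fun z hz => by
    rw [fn_T_abs _ _ hz, fn_S_pow _ _ hz, fn_S_pow _ _ hz, fn_T_abs _ _ hz]; ring

lemma norm_T_e (lam : ℝ) : ‖T lam (e 0)‖ = 1 := by
  apply le_antisymm ((norm_T_le _ _).trans (norm_e 0).le)
  have hps : PS (phi |lam|) (T lam (e 0)) := by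
    refine (ps_fn _).congr fun z hz => ?_
    rw [fn_T_abs _ _ hz, fn_e, mul_one]
  have hle : ∀ r ∈ Ico (0 : ℝ) 1,
      (∫ t : UnitAddCircle, ‖phi |lam| (r * AddCircle.toCircle t)‖ ^ 2 ∂AddCircle.haarAddCircle)
        ≤ ‖T lam (e 0)‖ ^ 2 := by
    intro r ⟨hr0, hr1⟩
    refine hasSum_le (fun n => ?_) (hps.parseval hr0 hr1) (hasSum_normSq _)
    exact mul_le_of_le_one_right (by positivity) (pow_le_one₀ hr0 hr1.le)
  have hmem : ∀ r ∈ Ico (0 : ℝ) 1, ∀ t : UnitAddCircle,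
      (r : ℂ) * AddCircle.toCircle t ∈ ball (0 : ℂ) 1 := by
    intro r ⟨hr0, hr1⟩ t
    have : ‖(AddCircle.toCircle t : ℂ)‖ = 1 := Circle.norm_coe _
    simpa [abs_of_nonneg hr0, this] using hr1
  have hev : ∀ᶠ r : ℝ in 𝓝[<] 1, r ∈ Ico (0 : ℝ) 1 := Ico_mem_nhdsLT (zero_lt_one' ℝ)
  have hlim : Tendsto (fun r : ℝ => ∫ t : UnitAddCircle,
      ‖phi |lam| (r * AddCircle.toCircle t)‖ ^ 2 ∂AddCircle.haarAddCircle) (𝓝[<] 1)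
      (𝓝 (∫ t : UnitAddCircle, (1 : ℝ) ∂AddCircle.haarAddCircle)) := by
    apply tendsto_integral_filter_of_dominated_convergence (fun _ => 1)
    · filter_upwards [hev] with r hr
      have : Continuous fun t : UnitAddCircle => phi |lam| (r * AddCircle.toCircle t) := by
        apply (phi_diff |lam|).continuousOn.comp_continuous _ (hmem r hr)
        have := (AddCircle.continuous_toCircle (T := 1))
        fun_prop
      exact (this.norm.pow 2).aestronglyMeasurable
    · filter_upwards [hev] with r hr
      refine Eventually.of_forall fun t => ?_
      rw [Real.norm_of_nonneg (by positivity)]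
      exact pow_le_one₀ (norm_nonneg _) (phi_bound (abs_nonneg _) _ (hmem r hr t))
    · exact integrable_const _
    · have hne : ∀ᵐ t : UnitAddCircle ∂AddCircle.haarAddCircle,
          (AddCircle.toCircle t : ℂ) ≠ -1 := by
        have hss : {t : UnitAddCircle | (AddCircle.toCircle t : ℂ) = -1}.Subsingleton := by
          intro s hs t ht
          apply AddCircle.injective_toCircle (T := 1) one_ne_zero
          apply Circle.ext
          rw [hs, ht]
        have hnt0 : Nontrivial (Ico (0 : ℝ) (0 + 1)) :=
          ⟨⟨0, by simp⟩, ⟨1 / 2, by norm_num⟩, by simp⟩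
        have hnt : Nontrivial UnitAddCircle := (AddCircle.equivIco (1 : ℝ) 0).nontrivial
        have := hss.measure_zero (AddCircle.haarAddCircle (T := 1))
        simpa [ae_iff] using this
      filter_upwards [hne] with t ht
      have h1 : ‖(AddCircle.toCircle t : ℂ)‖ = 1 := Circle.norm_coe _
      set ζ : ℂ := (AddCircle.toCircle t : ℂ) with hζ
      have hz : 1 + ζ ≠ 0 := fun h => ht (by linear_combination h)
      have hc : ContinuousAt (fun r : ℝ => ‖phi |lam| (r * ζ)‖ ^ 2) 1 := by
        have : ContinuousAt (phi |lam|) (((1 : ℝ) : ℂ) * ζ) := by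
          unfold phi
          have : 1 + ((1 : ℝ) : ℂ) * ζ ≠ 0 := by simpa using hz
          fun_prop (disch := assumption)
        have h2 : ContinuousAt (fun r : ℝ => (r : ℂ) * ζ) 1 := by fun_prop
        exact ((ContinuousAt.comp (f := fun r : ℝ => (r : ℂ) * ζ) this h2).norm).pow 2
      have h3 := hc.tendsto.mono_left (nhdsWithin_le_nhds (s := Iio 1))
      have h4 : ‖phi |lam| (((1 : ℝ) : ℂ) * ζ)‖ ^ 2 = 1 := by
        rw [norm_phi, Complex.ofReal_one, one_mul, re_cayley_circle _ h1]; simp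
      rwa [h4] at h3
  have h5 : (1 : ℝ) ≤ ‖T lam (e 0)‖ ^ 2 := by
    have := le_of_tendsto hlim (hev.mono hle)
    simpa using this
  nlinarith [norm_nonneg (T lam (e 0))]

lemma norm_T (lam : ℝ) (a : H) : ‖T lam a‖ = ‖a‖ := by
  have he : ∀ n, ‖T lam (e n)‖ = 1 := by
    intro n
    rw [← S_pow_e, T_S_pow, norm_S_pow, norm_T_e]
  have key : ∀ n, (T lam).adjoint (T lam (e n)) = e n := by
    intro n
    rw [← sub_eq_zero, ← norm_eq_zero, ← sq_eq_zero_iff]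
    apply le_antisymm _ (by positivity)
    rw [@norm_sub_sq ℂ, ContinuousLinearMap.adjoint_inner_left, inner_self_eq_norm_sq, he, norm_e]
    have h1 : ‖(T lam).adjoint (T lam (e n))‖ ≤ 1 := by
      refine ((T lam).adjoint.le_opNorm _).trans ?_
      rw [he, mul_one, LinearIsometryEquiv.norm_map]
      exact ContinuousLinearMap.opNorm_le_bound _ zero_le_one fun a => by
        rw [one_mul]; exact norm_T_le lam a
    nlinarith [norm_nonneg ((T lam).adjoint (T lam (e n)))]
  have key2 : (T lam).adjoint (T lam a) = a := by
    rw [← sub_eq_zero]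
    apply ext_e
    intro n
    rw [inner_sub_right, ContinuousLinearMap.adjoint_inner_right,
      ← ContinuousLinearMap.adjoint_inner_left, key, sub_self]
  have h2 : inner ℂ (T lam a) (T lam a) = (inner ℂ a a : ℂ) := by
    rw [← ContinuousLinearMap.adjoint_inner_right, key2]
  have h3 := congrArg RCLike.re h2
  rw [inner_self_eq_norm_sq, inner_self_eq_norm_sq] at h3
  exact (sq_eq_sq₀ (norm_nonneg _) (norm_nonneg _)).1 h3

end Hardy

namespace Hardy

open Filter Topology Polynomial
open scoped ComplexConjugate

lemma fn_aeval (p : ℂ[X]) (a : H) {z : ℂ} (hz : z ∈ ball (0 : ℂ) 1) :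
    fn (aeval S p a) z = p.eval z * fn a z := by
  induction p using Polynomial.induction_on' with
  | add p q hp hq =>
    rw [map_add, add_apply, fn_add _ _ hz, hp, hq, eval_add, add_mul]
  | monomial n c =>
    rw [aeval_monomial, mul_apply_eq_comp, eval_monomial, Algebra.algebraMap_eq_smul_one, smul_apply,
      one_apply_eq_self, fn_smul _ _ hz, fn_S_pow _ _ hz, mul_assoc]

lemma T_aeval (lam : ℝ) (p : ℂ[X]) (a : H) : T lam (aeval S p a) = aeval S p (T lam a) :=
  ext_fn fun z hz => by
    rw [fn_T_abs _ _ hz, fn_aeval _ _ hz, fn_aeval _ _ hz, fn_T_abs _ _ hz]; ring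

lemma aeval_S_pow (p : ℂ[X]) (n : ℕ) (a : H) : aeval S p ((S ^ n) a) = (S ^ n) (aeval S p a) :=
  ext_fn fun z hz => by
    rw [fn_aeval _ _ hz, fn_S_pow _ _ hz, fn_S_pow _ _ hz, fn_aeval _ _ hz]; ring

lemma aeval_e (p : ℂ[X]) : aeval S p (e 0) = ∑ i ∈ Finset.range (p.natDegree + 1), p.coeff i • e i := by
  rw [aeval_eq_sum_range, sum_apply]
  refine Finset.sum_congr rfl fun i _ => ?_
  rw [smul_apply, S_pow_e]

lemma inner_aeval_gt (p : ℂ[X]) (M : ℕ) (hM : p.natDegree < M) (h : H) :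
    inner ℂ (aeval S p (e 0)) ((S ^ M) h) = 0 := by
  rw [aeval_e, sum_inner]
  refine Finset.sum_eq_zero fun i hi => ?_
  rw [inner_smul_left, inner_e, S_pow_apply_lt, mul_zero]
  have := Finset.mem_range.1 hi
  omega

lemma inner_aeval_eq (p : ℂ[X]) (hp : p.Monic) (h : H) :
    inner ℂ (aeval S p (e 0)) ((S ^ p.natDegree) h) = h 0 := by
  rw [aeval_e, sum_inner, Finset.sum_range_succ, Finset.sum_eq_zero, zero_add, inner_smul_left,
    inner_e, S_pow_apply_self, hp.coeff_natDegree, map_one, one_mul]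
  intro i hi
  rw [inner_smul_left, inner_e, S_pow_apply_lt, mul_zero]
  exact Finset.mem_range.1 hi

lemma adjoint_factor_inj {w : ℂ} (hw : ‖w‖ = 1) {k : H}
    (h : ∀ x, inner ℂ (aeval S (X + C w) x) k = 0) : k = 0 := by
  have h1 : ∀ n, ‖k (n + 1)‖ = ‖k n‖ := by
    intro n
    have := h (e n)
    rw [map_add, aeval_X, aeval_C, add_apply, S_e,
      Algebra.algebraMap_eq_smul_one, smul_apply, one_apply_eq_self,
      inner_add_left, inner_smul_left, inner_e, inner_e] at this
    rw [eq_neg_of_add_eq_zero_left this, norm_neg, norm_mul, RCLike.norm_conj, hw, one_mul]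
  have h2 : ∀ n, ‖k n‖ = ‖k 0‖ := by
    intro n
    induction n with
    | zero => rfl
    | succ n ih => rw [h1, ih]
  have h3 := (hasSum_normSq k).summable.tendsto_atTop_zero
  simp_rw [h2] at h3
  have h4 := tendsto_nhds_unique h3 tendsto_const_nhds
  apply lp.ext
  ext n
  have : ‖k n‖ = 0 := by rw [h2]; exact pow_eq_zero_iff (two_ne_zero) |>.1 h4.symm
  simpa using this

lemma adjoint_prod_inj {ι : Type*} (s : Finset ι) (w : ι → ℂ) (hw : ∀ j, ‖w j‖ = 1) {k : H}
    (h : ∀ x, inner ℂ (aeval S (∏ j ∈ s, (X + C (w j))) x) k = 0) : k = 0 := by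
  classical
  induction s using Finset.induction_on generalizing k with
  | empty =>
    have := h k
    simpa using this
  | insert j s hj ih =>
    rw [Finset.prod_insert hj] at h
    apply adjoint_factor_inj (hw j)
    intro x
    have h5 : (aeval S (X + C (w j))).adjoint k = 0 := by
      apply ih
      intro x
      rw [ContinuousLinearMap.adjoint_inner_right]
      have := h x
      rwa [map_mul, mul_apply_eq_comp] at this
    rw [← ContinuousLinearMap.adjoint_inner_right, h5, inner_zero_right]

lemma norm_sub_T (s t : ℝ) : ‖T s (e 0) - T t (e 0)‖ ^ 2 = 2 - 2 * Real.exp (-|(|s| - |t|)|) := by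
  have main : ∀ s t : ℝ, 0 ≤ s → s ≤ t →
      ‖T s (e 0) - T t (e 0)‖ ^ 2 = 2 - 2 * Real.exp (-(t - s)) := by
    intro s t hs hst
    have h0 : 0 ≤ t - s := by linarith
    have h1 : T t (e 0) = T s (T (t - s) (e 0)) := by
      rw [← T_add hs h0]; congr 2; ring
    rw [h1, ← map_sub, norm_T, @norm_sub_sq ℂ, norm_T, norm_e, inner_e]
    have h2 : T (t - s) (e 0) 0 = Real.exp (-(t - s)) := by
      have h3 : fn (T (t - s) (e 0)) 0 = T (t - s) (e 0) 0 := by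
        rw [fn, tsum_eq_single 0]
        · simp
        · intro n hn; simp [hn]
      rw [← h3, fn_T h0 _ (by simp), fn_e, phi]
      push_cast
      simp
    rw [h2, RCLike.re_to_complex, Complex.ofReal_re]
    ring
  rw [← T_abs s, ← T_abs t]
  rcases le_total |s| |t| with h | h
  · rw [main _ _ (abs_nonneg _) h, abs_of_nonpos (sub_nonpos.2 h), neg_sub, neg_neg]
  · rw [norm_sub_rev, main _ _ (abs_nonneg _) h, abs_of_nonneg (sub_nonneg.2 h)]

lemma continuous_T_e : Continuous fun s => T s (e 0) := by
  rw [continuous_iff_continuousAt]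
  intro t
  rw [ContinuousAt, tendsto_iff_norm_sub_tendsto_zero]
  have h1 : (fun s => ‖T s (e 0) - T t (e 0)‖) =
      fun s => √(2 - 2 * Real.exp (-|(|s| - |t|)|)) := by
    ext s
    rw [← norm_sub_T, Real.sqrt_sq (norm_nonneg _)]
  rw [h1]
  have h2 : Continuous fun s : ℝ => √(2 - 2 * Real.exp (-|(|s| - |t|)|)) := by fun_prop
  simpa using h2.tendsto t

/-- Point evaluation as a functional. -/
lemma exists_kernel {z : ℂ} (hz : z ∈ ball (0 : ℂ) 1) : ∃ κ : H, ∀ a, inner ℂ κ a = fn a z := by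
  have hz' : ‖z‖ < 1 := by simpa using hz
  refine ⟨mkH (fun n => conj (z ^ n)) ?_, fun a => ?_⟩
  · have : ‖z‖ ^ 2 < 1 := by nlinarith [norm_nonneg z]
    refine (summable_geometric_of_lt_one (by positivity) this).congr fun n => ?_
    rw [RCLike.norm_conj, norm_pow, ← pow_mul, ← pow_mul, mul_comm]
  · rw [lp.inner_eq_tsum, fn]
    refine tsum_congr fun n => ?_
    rw [mkH_apply, RCLike.inner_apply, Complex.conj_conj]

lemma step (q : ℂ[X]) (k : H) (h : ∀ t, 0 ≤ t → inner ℂ (T t (aeval S q (e 0))) k = 0) :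
    ∀ t, 0 ≤ t → inner ℂ (T t (aeval S (q * (X + C 1)) (e 0))) k = 0 := by
  intro t ht
  set y := aeval S q (e 0) with hy
  have hcont : Continuous fun s => T s y := by
    simp_rw [hy, T_aeval]
    exact (aeval S q).continuous.comp continuous_T_e
  let G : ℝ → H := fun s => (Real.exp (-s) : ℂ) • T (t + s) y
  have hG : IntegrableOn G (Ioi 0) := by
    have h1 : IntegrableOn (fun s : ℝ => Real.exp (-s) * ‖y‖) (Ioi 0) :=
      (integrableOn_exp_neg_Ioi 0).mul_const _
    refine h1.mono' ?_ ?_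
    · apply Continuous.aestronglyMeasurable
      have : Continuous fun s => T (t + s) y := hcont.comp (by fun_prop)
      fun_prop
    · refine Eventually.of_forall fun s => ?_
      rw [norm_smul, norm_T, Complex.norm_real, Real.norm_of_nonneg (Real.exp_pos _).le]
  have hval : (2 : ℂ) • ∫ s in Ioi (0 : ℝ), G s = T t (aeval S (q * (X + C 1)) (e 0)) := by
    apply ext_fn
    intro z hz
    obtain ⟨κ, hκ⟩ := exists_kernel hz
    have hne := one_add_ne hz
    rw [fn_smul _ _ hz, ← hκ, ← integral_inner hG, fn_T ht _ hz, fn_aeval _ _ hz, fn_e]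
    have h2 : ∀ s ∈ Ioi (0 : ℝ), inner ℂ κ (G s) =
        phi t z * q.eval z * Complex.exp (-(2 / (1 + z)) * s) := by
      intro s hs
      rw [hκ, fn_smul _ _ hz, fn_T (add_nonneg ht (le_of_lt hs)) _ hz, phi_add, hy,
        fn_aeval _ _ hz, fn_e]
      have : Complex.exp (-(2 / (1 + z)) * s) = (Real.exp (-s) : ℂ) * phi s z := by
        rw [phi]; push_cast
        rw [← Complex.exp_add]
        congr 1
        field_simp
        ring
      rw [this]
      ring
    rw [setIntegral_congr_fun measurableSet_Ioi h2, integral_const_mul,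
      integral_exp_mul_complex_Ioi]
    · simp
      field_simp
      ring
    · have h3 : -(2 / (1 + z)) = -1 - (1 - z) / (1 + z) := by field_simp; ring
      rw [h3]
      have := re_cayley z (mem_ball_zero_iff.1 hz).le
      simp only [Complex.sub_re, Complex.neg_re, Complex.one_re]
      linarith
  rw [← hval, inner_smul_left, ← inner_conj_symm, ← integral_inner hG]
  have h4 : ∀ s ∈ Ioi (0 : ℝ), inner ℂ k (G s) = (0 : ℂ) := by
    intro s hs
    rw [inner_smul_right, ← inner_conj_symm, h _ (add_nonneg ht (le_of_lt hs))]
    simp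
  rw [setIntegral_congr_fun measurableSet_Ioi h4]
  simp

lemma complete {N : ℕ} (w : Fin N → ℂ) (hw : ∀ j, ‖w j‖ = 1) (k : H)
    (h : ∀ t, 0 ≤ t → inner ℂ (T t (aeval S (∏ j, (X + C (w j))) (e 0))) k = 0) : k = 0 := by
  set p : ℂ[X] := ∏ j, (X + C (w j)) with hp
  have h1 : ∀ n : ℕ, ∀ t, 0 ≤ t → inner ℂ (T t (aeval S (p * (X + C 1) ^ n) (e 0))) k = 0 := by
    intro n
    induction n with
    | zero => simpa using h
    | succ n ih => rw [pow_succ, ← mul_assoc]; exact step _ _ ih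
  have hT0 : ∀ a, T 0 a = a := fun a => ext_fn fun z hz => by
    rw [fn_T le_rfl _ hz]; simp [phi]
  have h2 : ∀ q : ℂ[X], inner ℂ (aeval S (p * q) (e 0)) k = 0 := by
    intro q
    have : ∀ q : ℂ[X], inner ℂ (aeval S (p * q.comp (X + C 1)) (e 0)) k = 0 := by
      intro q
      induction q using Polynomial.induction_on' with
      | add a b ha hb =>
        rw [add_comp, mul_add, map_add, add_apply, inner_add_left, ha, hb,
          add_zero]
      | monomial n c =>
        have h3 := h1 n 0 le_rfl
        rw [hT0] at h3
        rw [monomial_comp, mul_left_comm, ← smul_eq_C_mul, map_smul,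
          smul_apply, inner_smul_left, h3, mul_zero]
    have h4 := this (q.comp (X - C 1))
    rw [comp_assoc] at h4
    simpa using h4
  apply adjoint_prod_inj Finset.univ w hw
  rw [← hp]
  have h5 : (aeval S p).adjoint k = 0 := by
    apply ext_e
    intro n
    rw [ContinuousLinearMap.adjoint_inner_right]
    have := h2 (X ^ n)
    rwa [map_mul, map_pow, aeval_X, mul_apply_eq_comp, S_pow_e] at this
  intro x
  rw [← ContinuousLinearMap.adjoint_inner_right, h5, inner_zero_right]

end Hardy

namespace Hardy

open Filter Topology Polynomial
open scoped ComplexConjugate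

/-- The polynomial `∏ (X + w_j)`. -/
noncomputable def pt {N : ℕ} (w : Fin N → ℂ) : ℂ[X] := ∏ j, (X + C (w j))

lemma pt_monic {N : ℕ} (w : Fin N → ℂ) : (pt w).Monic :=
  monic_prod_of_monic _ _ fun j _ => monic_X_add_C (w j)

lemma pt_natDegree {N : ℕ} (w : Fin N → ℂ) : (pt w).natDegree = N := by
  rw [pt, natDegree_prod_of_monic _ _ fun j _ => monic_X_add_C (w j)]
  simp

/-- The vectors `p̃ φ^t`. -/
noncomputable def v {N : ℕ} (w : Fin N → ℂ) (t : ℝ) : H := T t (aeval S (pt w) (e 0))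

lemma fn_v {N : ℕ} (w : Fin N → ℂ) {t : ℝ} (ht : 0 ≤ t) {z : ℂ} (hz : z ∈ ball (0 : ℂ) 1) :
    fn (v w t) z = (∏ j, (z + w j)) * phi t z := by
  rw [v, fn_T ht _ hz, fn_aeval _ _ hz, fn_e, pt, eval_prod]
  simp [mul_comm]

/-- Multiplication by `z ^ M * φ^δ`. -/
noncomputable def V (δ : ℝ) (M : ℕ) : H →L[ℂ] H := S ^ M * T δ

lemma V_apply (δ : ℝ) (M : ℕ) (a : H) : V δ M a = (S ^ M) (T δ a) := by
  rw [V, mul_apply_eq_comp]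

lemma norm_V (δ : ℝ) (M : ℕ) (a : H) : ‖V δ M a‖ = ‖a‖ := by
  rw [V_apply, norm_S_pow, norm_T]

lemma fn_V {δ : ℝ} (hδ : 0 ≤ δ) (M : ℕ) (a : H) {z : ℂ} (hz : z ∈ ball (0 : ℂ) 1) :
    fn (V δ M a) z = z ^ M * phi δ z * fn a z := by
  rw [V_apply, fn_S_pow _ _ hz, fn_T hδ _ hz, mul_assoc]

lemma inner_v_V {δ : ℝ} {N : ℕ} (w : Fin N → ℂ) {t : ℝ} (ht : t ∈ Icc 0 δ) (h : H) :
    inner ℂ (v w t) (V δ (N + 1) h) = 0 := by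
  have h0 : 0 ≤ δ - t := sub_nonneg.2 ht.2
  have h1 : T δ h = T t (T (δ - t) h) := by
    rw [← T_add ht.1 h0]; congr 2; ring
  rw [V_apply, h1, ← T_S_pow, v, inner_of_isometry (norm_T t), inner_aeval_gt]
  rw [pt_natDegree]; omega

lemma part1 {δ : ℝ} (hδ : 0 < δ) {N : ℕ} (w : Fin N → ℂ) (hw : ∀ j, ‖w j‖ = 1) (f : H)
    (h1 : ∀ t ∈ Icc 0 δ, inner ℂ (v w t) f = 0) (h2 : ∀ n < N, inner ℂ (T δ (e n)) f = 0) :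
    ∃ h, f = V δ (N + 1) h := by
  set h := (V δ N).adjoint f with hh
  set k := f - V δ N h with hk
  have hf : f = k + V δ N h := by rw [hk]; abel
  have k1 : ∀ x, inner ℂ (V δ N x) k = 0 := by
    intro x
    rw [hk, inner_sub_right, inner_of_isometry (norm_V δ N), hh,
      ContinuousLinearMap.adjoint_inner_right, sub_self]
  have k2 : ∀ n, inner ℂ (T δ (e n)) k = 0 := by
    intro n
    by_cases hn : n < N
    · rw [hk, inner_sub_right, h2 n hn, V_apply, ← T_S_pow, inner_of_isometry (norm_T δ), inner_e,
        S_pow_apply_lt _ _ _ hn, sub_zero]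
    · obtain ⟨m, rfl⟩ := Nat.exists_eq_add_of_le (not_lt.1 hn)
      have := k1 (e m)
      have hs : (S ^ N) (e m) = e (N + m) := by
        rw [← S_pow_e m, ← mul_apply_eq_comp, ← pow_add, S_pow_e]
      rwa [V_apply, ← T_S_pow, hs] at this
  have k3 : ∀ x, inner ℂ (T δ x) k = 0 := by
    have h5 : (T δ).adjoint k = 0 := by
      apply ext_e
      intro n
      rw [ContinuousLinearMap.adjoint_inner_right, k2]
    intro x
    rw [← ContinuousLinearMap.adjoint_inner_right, h5, inner_zero_right]
  have h0 : h 0 = 0 := by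
    have := h1 δ ⟨hδ.le, le_rfl⟩
    rw [hf, inner_add_right, v, k3, zero_add, V_apply, ← T_S_pow, inner_of_isometry (norm_T δ)] at this
    have h6 := inner_aeval_eq (pt w) (pt_monic w) h
    rwa [pt_natDegree, this, eq_comm] at h6
  obtain ⟨h', hh'⟩ := eq_S_of_zero h0
  have hV : V δ N h = V δ (N + 1) h' := by
    have := T_S_pow δ 1 h'
    rw [pow_one] at this
    rw [hh', V_apply, V_apply, this, ← mul_apply_eq_comp, ← pow_succ]
  have hk0 : k = 0 := by
    apply complete w hw
    intro t ht
    change inner ℂ (v w t) k = 0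
    by_cases htd : t ≤ δ
    · rw [hk, inner_sub_right, h1 t ⟨ht, htd⟩, hV, inner_v_V w ⟨ht, htd⟩, sub_zero]
    · have : v w t = T δ (v w (t - δ)) := by
        rw [v, v, ← T_add hδ.le (by linarith)]; congr 2; ring
      rw [this, k3]
  exact ⟨h', by rw [hf, hk0, zero_add, hV]⟩

/-- The model space `K_{z^M φ^δ}`. -/
noncomputable def K (δ : ℝ) (M : ℕ) : Submodule ℂ H := (LinearMap.range (V δ M).toLinearMap)ᗮ

lemma mem_K {δ : ℝ} {M : ℕ} {a : H} : a ∈ K δ M ↔ ∀ h, inner ℂ (V δ M h) a = 0 := by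
  rw [K, Submodule.mem_orthogonal]
  constructor
  · intro h x; exact h _ ⟨x, rfl⟩
  · rintro h _ ⟨x, rfl⟩; exact h x

/-- The closed span `c(p̃_N)`. -/
noncomputable def Csp (δ : ℝ) {N : ℕ} (w : Fin N → ℂ) : Submodule ℂ H :=
  (Submodule.span ℂ (v w '' Icc 0 δ)).topologicalClosure

lemma v_mem {δ : ℝ} {N : ℕ} (w : Fin N → ℂ) {t : ℝ} (ht : t ∈ Icc 0 δ) : v w t ∈ Csp δ w :=
  Submodule.le_topologicalClosure _ (Submodule.subset_span ⟨t, ht, rfl⟩)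

lemma K_closed (δ : ℝ) (M : ℕ) : IsClosed (K δ M : Set H) := Submodule.isClosed_orthogonal _

lemma Csp_le {δ : ℝ} {N : ℕ} (w : Fin N → ℂ) : Csp δ w ≤ K δ (N + 1) := by
  apply Submodule.topologicalClosure_minimal _ _ (K_closed _ _)
  rw [Submodule.span_le]
  rintro _ ⟨t, ht, rfl⟩
  rw [SetLike.mem_coe, mem_K]
  intro h
  rw [← inner_conj_symm, inner_v_V w ht, map_zero]

lemma K_le {δ : ℝ} {N : ℕ} : K δ N ≤ K δ (N + 1) := by
  intro a ha
  rw [mem_K] at ha ⊢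
  intro h
  have := T_S_pow δ 1 h
  rw [pow_one] at this
  have h2 := ha (S h)
  rwa [V_apply, this, ← mul_apply_eq_comp, ← pow_succ, ← V_apply] at h2

lemma T_e_mem {δ : ℝ} {N n : ℕ} (hn : n < N) : T δ (e n) ∈ K δ N := by
  rw [mem_K]
  intro h
  rw [V_apply, ← T_S_pow, inner_of_isometry (norm_T δ), ← inner_conj_symm, inner_e,
    S_pow_apply_lt _ _ _ hn, map_zero]

lemma part2 {δ : ℝ} (hδ : 0 < δ) {N : ℕ} (w : Fin N → ℂ) (hw : ∀ j, ‖w j‖ = 1) :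
    (Csp δ w ⊔ K δ N).topologicalClosure = K δ (N + 1) := by
  apply le_antisymm
  · exact Submodule.topologicalClosure_minimal _ (sup_le (Csp_le w) K_le) (K_closed _ _)
  · rw [← Submodule.orthogonal_orthogonal_eq_closure]
    rw [K]
    apply Submodule.orthogonal_le
    intro f hf
    rw [Submodule.mem_orthogonal] at hf
    obtain ⟨h, rfl⟩ := part1 hδ w hw f
      (fun t ht => hf _ (Submodule.mem_sup_left (v_mem w ht)))
      (fun n hn => hf _ (Submodule.mem_sup_right (T_e_mem hn)))
    exact ⟨h, rfl⟩

lemma fn_sub (a b : H) {z : ℂ} (hz : z ∈ ball (0 : ℂ) 1) : fn (a - b) z = fn a z - fn b z := by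
  rw [eq_sub_iff_add_eq, ← fn_add _ _ hz, sub_add_cancel]

lemma fn_zero {z : ℂ} : fn 0 z = 0 := by
  simp [fn]

lemma fn_sum {ι : Type*} (s : Finset ι) (a : ι → H) {z : ℂ} (hz : z ∈ ball (0 : ℂ) 1) :
    fn (∑ i ∈ s, a i) z = ∑ i ∈ s, fn (a i) z := by
  classical
  induction s using Finset.induction_on with
  | empty => simp [fn_zero]
  | insert j s hj ih => rw [Finset.sum_insert hj, Finset.sum_insert hj, fn_add _ _ hz, ih]

lemma ps_of {f : ℂ → ℂ} {a : H} (h : ∀ z ∈ ball (0 : ℂ) 1, f z = fn a z) : PS f a :=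
  (ps_fn a).congr h

lemma memH2_of {f : ℂ → ℂ} {a : H} (h : PS f a) : MemH2 f := by
  refine ⟨h.differentiableOn, ?_⟩
  simp_rw [h.coeff_eq]
  exact (hasSum_normSq a).summable

lemma exists_ps {f : ℂ → ℂ} (h : MemH2 f) : ∃ a : H, PS f a :=
  ⟨mkH _ h.2, PS.of_differentiableOn h.1⟩

lemma hinner_eq {f g : ℂ → ℂ} {a b : H} (hf : PS f a) (hg : PS g b) :
    hinner f g = inner ℂ a b := by
  rw [hinner, lp.inner_eq_tsum]
  refine tsum_congr fun n => ?_
  rw [hf.coeff_eq, hg.coeff_eq, RCLike.inner_apply, mul_comm]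

lemma hnormSq_eq {f : ℂ → ℂ} {a : H} (hf : PS f a) : hnormSq f = ‖a‖ ^ 2 := by
  rw [hnormSq]
  simp_rw [hf.coeff_eq]
  exact (hasSum_normSq a).tsum_eq

lemma memK_iff {δ : ℝ} (hδ : 0 ≤ δ) (M : ℕ) {q : ℂ → ℂ} {b : H} (hq : PS q b) :
    MemK (fun z => z ^ M * phi δ z) q ↔ b ∈ K δ M := by
  rw [mem_K]
  constructor
  · rintro ⟨-, h⟩ x
    rw [← h _ (memH2_of (ps_fn x))]
    refine (hinner_eq (ps_of fun z hz => ?_) hq).symm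
    rw [fn_V hδ _ _ hz]
  · refine fun h => ⟨memH2_of hq, fun g hg => ?_⟩
    obtain ⟨x, hx⟩ := exists_ps hg
    rw [← h x]
    refine hinner_eq (ps_of fun z hz => ?_) hq
    simp only
    rw [fn_V hδ _ _ hz, hx.eq_fn hz]

lemma memK_pow_iff (M : ℕ) {q : ℂ → ℂ} {b : H} (hq : PS q b) :
    MemK (fun z => z ^ M) q ↔ ∀ x, inner ℂ ((S ^ M) x) b = 0 := by
  constructor
  · rintro ⟨-, h⟩ x
    rw [← h _ (memH2_of (ps_fn x))]
    refine (hinner_eq (ps_of fun z hz => ?_) hq).symm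
    rw [fn_S_pow _ _ hz]
  · refine fun h => ⟨memH2_of hq, fun g hg => ?_⟩
    obtain ⟨x, hx⟩ := exists_ps hg
    rw [← h x]
    refine hinner_eq (ps_of fun z hz => ?_) hq
    simp only
    rw [fn_S_pow _ _ hz, hx.eq_fn hz]

lemma inClosedSpan_iff {δ : ℝ} {N : ℕ} (w : Fin N → ℂ) {f : ℂ → ℂ} {a : H} (hf : PS f a) :
    InClosedSpan (fun lam z => (∏ j, (z + w j)) * phi lam z) (Set.Icc 0 δ) f ↔ a ∈ Csp δ w := by
  have key : ∀ (n : ℕ) (c : Fin n → ℂ) (lam : Fin n → ℝ), (∀ i, lam i ∈ Icc 0 δ) →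
      hnormSq (fun z => f z - ∑ i, c i * ((∏ j, (z + w j)) * phi (lam i) z)) =
        ‖a - ∑ i, c i • v w (lam i)‖ ^ 2 := by
    intro n c lam hl
    apply hnormSq_eq
    apply ps_of
    intro z hz
    rw [fn_sub _ _ hz, fn_sum _ _ hz, hf.eq_fn hz]
    congr 1
    refine Finset.sum_congr rfl fun i _ => ?_
    rw [fn_smul _ _ hz, fn_v w (hl i).1 hz]
  rw [Csp, ← SetLike.mem_coe, Submodule.topologicalClosure_coe, Metric.mem_closure_iff]
  constructor
  · rintro ⟨-, h⟩ ε hε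
    obtain ⟨n, c, lam, hl, hlt⟩ := h (ε ^ 2) (by positivity)
    rw [key n c lam hl] at hlt
    refine ⟨∑ i, c i • v w (lam i), ?_, ?_⟩
    · exact Submodule.sum_mem _ fun i _ =>
        Submodule.smul_mem _ _ (Submodule.subset_span ⟨_, hl i, rfl⟩)
    · rw [dist_eq_norm]
      exact lt_of_pow_lt_pow_left₀ 2 hε.le hlt
  · refine fun h => ⟨memH2_of hf, fun ε hε => ?_⟩
    obtain ⟨b, hb, hd⟩ := h (√ε) (Real.sqrt_pos.2 hε)
    obtain ⟨n, c, g, rfl⟩ := Submodule.mem_span_set'.1 hb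
    choose lam hl hg using fun i => (g i).2
    refine ⟨n, c, lam, hl, ?_⟩
    rw [key n c lam hl]
    simp_rw [hg]
    rw [dist_eq_norm] at hd
    calc _ < √ε ^ 2 := by gcongr
      _ = ε := Real.sq_sqrt hε.le

end Hardy

open Hardy in
/-- With p̃_N(z) = ∏ (z + w_j), w_j ∈ 𝕋, and c(p̃_N) the closed span of {p̃_N φ^λ : 0 ≤ λ ≤ δ}:
(c(p̃_N) + φ^δ K_{z^N})^⊥ = z^{N+1}φ^δ H²(𝔻), and consequently the closure of
c(p̃_N) + K_{z^N φ^δ} equals K_{z^{N+1}φ^δ}. -/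
theorem stmt19 (δ : ℝ) (hδ : 0 < δ) (N : ℕ) (hN : 1 ≤ N)
    (w : Fin N → ℂ) (hw : ∀ j, ‖w j‖ = 1) :
    (∀ f, (MemH2 f ∧ ∀ g : ℂ → ℂ,
        (∃ g₁ q : ℂ → ℂ,
          InClosedSpan (fun lam z => (∏ j, (z + w j)) * phi lam z) (Set.Icc 0 δ) g₁ ∧
          MemK (fun z => z ^ N) q ∧ ∀ z, g z = g₁ z + phi δ z * q z) →
        hinner g f = 0)
      ↔ ∃ h, MemH2 h ∧
          Set.EqOn f (fun z => z ^ (N + 1) * phi δ z * h z) (ball (0 : ℂ) 1)) ∧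
    (∀ f, (MemH2 f ∧ ∀ ε > (0 : ℝ), ∃ g₁ q : ℂ → ℂ,
          InClosedSpan (fun lam z => (∏ j, (z + w j)) * phi lam z) (Set.Icc 0 δ) g₁ ∧
          MemK (fun z => z ^ N * phi δ z) q ∧
          hnormSq (fun z => f z - (g₁ z + q z)) < ε)
      ↔ MemK (fun z => z ^ (N + 1) * phi δ z) f) := by
  have hg : ∀ {g g₁ q : ℂ → ℂ} {a b : H}, PS g₁ a → PS q b →
      (∀ z, g z = g₁ z + phi δ z * q z) → PS g (a + T δ b : H) := by
    intro g g₁ q a b ha hb h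
    refine ps_of fun z hz => ?_
    rw [h, fn_add _ _ hz, fn_T hδ.le _ hz, ha.eq_fn hz, hb.eq_fn hz]
  refine ⟨fun f => ⟨?_, ?_⟩, fun f => ⟨?_, ?_⟩⟩
  · rintro ⟨hf, h⟩
    obtain ⟨a, ha⟩ := exists_ps hf
    have main : ∀ c ∈ Csp δ w, ∀ b : H, (∀ x, inner ℂ ((S ^ N) x) b = 0) →
        inner ℂ (c + T δ b) a = 0 := by
      intro c hc b hb
      have h1 := hg (ps_fn c) (ps_fn b) (fun z => rfl)
      rw [← hinner_eq h1 ha]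
      exact h _ ⟨fn c, fn b, (inClosedSpan_iff w (ps_fn c)).2 hc,
        (memK_pow_iff N (ps_fn b)).2 hb, fun z => rfl⟩
    obtain ⟨x, hx⟩ := part1 hδ w hw a
      (fun t ht => by simpa using main _ (v_mem w ht) 0 (by simp))
      (fun n hn => by
        have := main 0 (Submodule.zero_mem _) (e n) (fun x => by
          rw [← inner_conj_symm, inner_e, S_pow_apply_lt _ _ _ hn, map_zero])
        rwa [zero_add] at this)
    refine ⟨fn x, memH2_of (ps_fn x), fun z hz => ?_⟩
    simp only
    rw [ha.eq_fn hz, hx, fn_V hδ.le _ _ hz]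
  · rintro ⟨h, hh, hfh⟩
    obtain ⟨x, hx⟩ := exists_ps hh
    have hf : PS f (V δ (N + 1) x) := ps_of fun z hz => by
      have h0 := hfh hz
      simp only at h0
      rw [h0, fn_V hδ.le _ _ hz, hx.eq_fn hz]
    refine ⟨memH2_of hf, ?_⟩
    rintro g ⟨g₁, q, h1, h2, h3⟩
    obtain ⟨c, hc⟩ := exists_ps h1.1
    obtain ⟨b, hb⟩ := exists_ps h2.1
    rw [hinner_eq (hg hc hb h3) hf, inner_add_left]
    have h4 := mem_K.1 (Csp_le w ((inClosedSpan_iff w hc).1 h1)) x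
    have h5 := (memK_pow_iff N hb).1 h2 (S x)
    rw [← inner_conj_symm, h4, map_zero, zero_add, V_apply, ← T_S_pow,
      inner_of_isometry (norm_T δ), pow_succ, mul_apply_eq_comp, ← inner_conj_symm, h5, map_zero]
  · rintro ⟨hf, h⟩
    obtain ⟨a, ha⟩ := exists_ps hf
    rw [memK_iff hδ.le _ ha, ← part2 hδ w hw, ← SetLike.mem_coe,
      Submodule.topologicalClosure_coe, Metric.mem_closure_iff]
    intro ε hε
    obtain ⟨g₁, q, h1, h2, h3⟩ := h (ε ^ 2) (by positivity)
    obtain ⟨c, hc⟩ := exists_ps h1.1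
    obtain ⟨b, hb⟩ := exists_ps h2.1
    refine ⟨c + b, Submodule.add_mem_sup ((inClosedSpan_iff w hc).1 h1)
      ((memK_iff hδ.le _ hb).1 h2), ?_⟩
    rw [hnormSq_eq (a := a - (c + b)) (ps_of fun z hz => by
      rw [fn_sub _ _ hz, fn_add _ _ hz, ha.eq_fn hz, hb.eq_fn hz, hc.eq_fn hz])] at h3
    rw [dist_eq_norm]
    exact lt_of_pow_lt_pow_left₀ 2 hε.le h3
  · intro h
    obtain ⟨a, ha⟩ := exists_ps h.1
    rw [memK_iff hδ.le _ ha, ← part2 hδ w hw, ← SetLike.mem_coe,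
      Submodule.topologicalClosure_coe, Metric.mem_closure_iff] at h
    refine ⟨memH2_of ha, fun ε hε => ?_⟩
    obtain ⟨y, hy, hd⟩ := h (√ε) (Real.sqrt_pos.2 hε)
    obtain ⟨c, hc, b, hb, rfl⟩ := Submodule.mem_sup.1 hy
    refine ⟨fn c, fn b, (inClosedSpan_iff w (ps_fn c)).2 hc,
      (memK_iff hδ.le _ (ps_fn b)).2 hb, ?_⟩
    rw [hnormSq_eq (a := a - (c + b)) (ps_of fun z hz => by
      rw [fn_sub _ _ hz, fn_add _ _ hz, ha.eq_fn hz])]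
    rw [dist_eq_norm] at hd
    calc _ < √ε ^ 2 := by gcongr
      _ = ε := Real.sq_sqrt hε.le
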